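/- arXiv:1812.04965 — 3 statements merged into one kernel-verified Lean document; each statement's English description precedes it below -/
import Mathlib

section
/- Let J : ℚ_p^n → [0,∞) satisfy Hypothesis A. Then for every ξ ∈ ℚ_p^n with ξ ≠ 0, 1 − (FJ)(ξ) = ‖ξ‖_p^{−n} [ p^n J(p‖ξ‖_p^{−1}) + (1 − p^{−n}) Σ_{j=2}^∞ p^{nj} J(p^j‖ξ‖_p^{−1}) ], where J(r) denotes the common value of J on the sphere {x ∈ ℚ_p^n : ‖x‖_p = r}. -/
open MeasureTheory Filter

noncomputable section

namespace PadicPaper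

attribute [local instance] Classical.propDecidable

variable (p : ℕ) [Fact p.Prime]

instance : MeasurableSpace ℚ_[p] := borel _
instance : BorelSpace ℚ_[p] := ⟨rfl⟩

variable (n : ℕ)

/-- `ℚ_p^n` with the sup norm `‖x‖ = max |x i|_p`. -/
abbrev V := Fin n → ℚ_[p]

/-- The `p`-adic fractional part of `y`: the unique rational `r ∈ [0,1)` whose denominator is a
power of `p` such that `y - r ∈ ℤ_p`. -/
def frac (y : ℚ_[p]) : ℚ :=
  if h : ∃ r : ℚ, 0 ≤ r ∧ r < 1 ∧ (∃ m : ℕ, (r * (p : ℚ) ^ m).den = 1) ∧ ‖y - (r : ℚ_[p])‖ ≤ 1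
  then h.choose else 0

/-- The standard additive character `χ_p(y) = exp(2 π i {y}_p)` of `ℚ_p`. -/
def stdChar (y : ℚ_[p]) : ℂ := Complex.exp (2 * Real.pi * Complex.I * (frac p y : ℂ))

/-- `ξ·x = Σ ξ_i x_i`. -/
def dotP (ξ x : V p n) : ℚ_[p] := ∑ i, ξ i * x i

/-- Fourier transform with respect to the (normalized Haar) measure `μ`:
`(Ff)(ξ) = ∫ χ_p(ξ·x) f(x) dμ(x)`. -/
def FT (μ : Measure (V p n)) (f : V p n → ℂ) (ξ : V p n) : ℂ :=
  ∫ x, stdChar p (dotP p n ξ x) * f x ∂μ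

/-- `ℤ_p^n` as a subset of `ℚ_p^n`. -/
def Zpn : Set (V p n) := {x | ‖x‖ ≤ 1}

/-- Hypothesis A: `J` is a nonnegative radial a.e.-continuous function with total integral 1. -/
structure HypA (μ : Measure (V p n)) (J : V p n → ℝ) : Prop where
  nonneg : ∀ x, 0 ≤ J x
  radial : ∀ x y : V p n, ‖x‖ = ‖y‖ → J x = J y
  aecont : ∀ᵐ x ∂μ, ContinuousAt J x
  integrable : Integrable J μ
  int_one : ∫ x, J x ∂μ = 1

/-- The Fourier transform of (the complexification of) `J`. -/
def FJ (μ : Measure (V p n)) (J : V p n → ℝ) (ξ : V p n) : ℂ :=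
  FT p n μ (fun x => (J x : ℂ)) ξ

/-- A representative point of `ℚ_p^n` of norm `r` (junk value `0` if no such point exists);
used to evaluate radial functions at a given radius. -/
def repVec (r : ℝ) : V p n :=
  if h : ∃ v : V p n, ‖v‖ = r then h.choose else 0

/-- The heat kernel
`Z_t(x) = ‖x‖^{-n} (1-p^{-n}) Σ_{j≥0} p^{-nj} (e^{-t(1-(FJ)(p^{-j}‖x‖⁻¹))} - e^{-t(1-(FJ)(p‖x‖⁻¹))})`. -/
def heatZ (μ : Measure (V p n)) (J : V p n → ℝ) (t : ℝ) (x : V p n) : ℝ :=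
  ‖x‖ ^ (-(n : ℤ)) * (1 - (p : ℝ) ^ (-(n : ℤ))) * ∑' j : ℕ,
    (p : ℝ) ^ (-((n * j : ℕ) : ℤ)) *
      (Real.exp (-(t * (1 - (FJ p n μ J (repVec p n ((p : ℝ) ^ (-(j : ℤ)) * ‖x‖⁻¹))).re))) -
       Real.exp (-(t * (1 - (FJ p n μ J (repVec p n ((p : ℝ) * ‖x‖⁻¹))).re))))

/-- `J` is of linear type: Hypothesis A together with `B‖x‖^{-(α+1)} ≤ J(x) ≤ C‖x‖^{-(α+1)}`. -/
structure LinearType (μ : Measure (V p n)) (J : V p n → ℝ) (B C α : ℝ) : Prop where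
  hypA : HypA p n μ J
  hB : 0 < B
  hBC : B ≤ C
  hα : 0 < α
  lower : ∀ x : V p n, x ≠ 0 → B / ‖x‖ ^ (α + 1) ≤ J x
  upper : ∀ x : V p n, x ≠ 0 → J x ≤ C / ‖x‖ ^ (α + 1)

/-- `J` is of logarithmic type: Hypothesis A together with
`D ln^α(1+‖x‖)‖x‖^{-β} ≤ J(x) ≤ E ln^α(1+‖x‖)‖x‖^{-β}`. -/
structure LogType (μ : Measure (V p n)) (J : V p n → ℝ) (D E α β : ℝ) : Prop where
  hypA : HypA p n μ J
  hD : 0 < D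
  hDE : D ≤ E
  hα : 0 < α
  hβ : 0 < β
  lower : ∀ x : V p n, x ≠ 0 → D * Real.log (1 + ‖x‖) ^ α / ‖x‖ ^ β ≤ J x
  upper : ∀ x : V p n, x ≠ 0 → J x ≤ E * Real.log (1 + ‖x‖) ^ α / ‖x‖ ^ β

/-- The lower incomplete gamma function `γ(s,x) = ∫_0^x z^{s-1} e^{-z} dz`. -/
def lgamma (s x : ℝ) : ℝ := ∫ z in (0:ℝ)..x, z ^ (s - 1) * Real.exp (-z)



lemma one_lt_p : (1 : ℝ) < p := by exact_mod_cast (Fact.out : p.Prime).one_lt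

lemma p_pos : (0 : ℝ) < p := lt_trans one_pos (one_lt_p p)

/-! ### The character -/

lemma int_of_frac (d : ℚ) (m : ℕ) (hd : (d * (p : ℚ) ^ m).den = 1)
    (h : ‖(d : ℚ_[p])‖ ≤ 1) : ∃ k : ℤ, d = k := by
  have hp : (p : ℚ) ≠ 0 := by exact_mod_cast (Fact.out : p.Prime).ne_zero
  set a : ℤ := (d * (p : ℚ) ^ m).num with ha
  have h1 : d * (p : ℚ) ^ m = (a : ℚ) := ((Rat.den_eq_one_iff _).1 hd).symm
  have h2 : (d : ℚ_[p]) * (p : ℚ_[p]) ^ m = (a : ℚ_[p]) := by exact_mod_cast congrArg (fun q : ℚ => (q : ℚ_[p])) h1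
  have h3 : ‖(a : ℚ_[p])‖ ≤ (p : ℝ) ^ (-m : ℤ) := by
    rw [← h2, norm_mul, Padic.norm_p_pow]
    exact mul_le_of_le_one_left (by positivity) h
  rw [Padic.norm_int_le_pow_iff_dvd] at h3
  obtain ⟨k, hk⟩ := h3
  refine ⟨k, ?_⟩
  rw [hk] at h1
  push_cast at h1
  rw [mul_comm] at h1
  exact mul_left_cancel₀ (pow_ne_zero m hp) h1

lemma frac_exists (y : ℚ_[p]) : ∃ r : ℚ, 0 ≤ r ∧ r < 1 ∧
    (∃ m : ℕ, (r * (p : ℚ) ^ m).den = 1) ∧ ‖y - (r : ℚ_[p])‖ ≤ 1 := by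
  have hp : (p : ℚ) ≠ 0 := by exact_mod_cast (Fact.out : p.Prime).ne_zero
  have hp' : (p : ℚ_[p]) ≠ 0 := by exact_mod_cast (Fact.out : p.Prime).ne_zero
  obtain ⟨m, hm⟩ : ∃ m : ℕ, ‖y‖ ≤ (p : ℝ) ^ m := by
    obtain ⟨m, hm⟩ := pow_unbounded_of_one_lt ‖y‖ (one_lt_p p)
    exact ⟨m, hm.le⟩
  have hpm : (0 : ℝ) < (p : ℝ) ^ m := pow_pos (p_pos p) m
  have hz : ‖y * (p : ℚ_[p]) ^ m‖ ≤ 1 := by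
    rw [norm_mul, Padic.norm_p_pow, zpow_neg, zpow_natCast]
    exact (mul_inv_le_iff₀ hpm).2 (by simpa using hm)
  let z : ℤ_[p] := ⟨y * (p : ℚ_[p]) ^ m, hz⟩
  have h1 := PadicInt.appr_spec m z
  rw [← PadicInt.norm_le_pow_iff_mem_span_pow] at h1
  have h2 := PadicInt.appr_lt z m
  refine ⟨(z.appr m : ℚ) / (p : ℚ) ^ m, by positivity, ?_, ⟨m, ?_⟩, ?_⟩
  · rw [div_lt_one (by have := (Fact.out : p.Prime).pos; positivity)]
    exact_mod_cast h2
  · rw [div_mul_cancel₀ _ (pow_ne_zero m hp)]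
    simp
  · have h3 : ‖y * (p : ℚ_[p]) ^ m - (z.appr m : ℚ_[p])‖ ≤ (p : ℝ) ^ (-m : ℤ) := by
      have := h1
      rw [PadicInt.norm_def] at this
      push_cast at this
      exact this
    have h4 : y - (((z.appr m : ℚ) / (p : ℚ) ^ m : ℚ) : ℚ_[p])
        = (y * (p : ℚ_[p]) ^ m - (z.appr m : ℚ_[p])) * ((p : ℚ_[p]) ^ m)⁻¹ := by
      push_cast
      field_simp
    rw [h4, norm_mul, norm_inv, Padic.norm_p_pow]
    rw [zpow_neg, zpow_natCast] at h3 ⊢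
    rw [inv_inv]
    calc _ ≤ ((p : ℝ) ^ m)⁻¹ * (p : ℝ) ^ m := by gcongr
      _ = 1 := inv_mul_cancel₀ hpm.ne'

lemma frac_spec (y : ℚ_[p]) : 0 ≤ frac p y ∧ frac p y < 1 ∧
    (∃ m : ℕ, (frac p y * (p : ℚ) ^ m).den = 1) ∧ ‖y - (frac p y : ℚ_[p])‖ ≤ 1 := by
  have h := frac_exists p y
  unfold frac
  rw [dif_pos h]
  exact h.choose_spec

lemma den_aux (a : ℚ) (m k : ℕ) (h : (a * (p : ℚ) ^ m).den = 1) :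
    (∃ z : ℤ, a * (p : ℚ) ^ (m + k) = z) := by
  refine ⟨(a * (p : ℚ) ^ m).num * (p : ℤ) ^ k, ?_⟩
  have h1 := ((Rat.den_eq_one_iff _).1 h)
  push_cast
  rw [h1]
  ring

lemma norm_add_le_one {x y : ℚ_[p]} (hx : ‖x‖ ≤ 1) (hy : ‖y‖ ≤ 1) : ‖x + y‖ ≤ 1 :=
  (Padic.nonarchimedean x y).trans (max_le hx hy)

lemma frac_add (x y : ℚ_[p]) : ∃ k : ℤ, frac p (x + y) = frac p x + frac p y + k := by
  obtain ⟨-, -, ⟨m1, h1⟩, n1⟩ := frac_spec p x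
  obtain ⟨-, -, ⟨m2, h2⟩, n2⟩ := frac_spec p y
  obtain ⟨-, -, ⟨m3, h3⟩, n3⟩ := frac_spec p (x + y)
  obtain ⟨z1, e1⟩ := den_aux p _ m1 (m2 + m3) h1
  obtain ⟨z2, e2⟩ := den_aux p _ m2 (m1 + m3) h2
  obtain ⟨z3, e3⟩ := den_aux p _ m3 (m1 + m2) h3
  obtain ⟨k, hk⟩ := int_of_frac p (frac p (x + y) - frac p x - frac p y) (m1 + m2 + m3) (by
    rw [show (frac p (x + y) - frac p x - frac p y) * (p : ℚ) ^ (m1 + m2 + m3)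
      = ((z3 - z1 - z2 : ℤ) : ℚ) by
        push_cast
        rw [← e1, ← e2, ← e3]
        ring]
    exact Rat.den_intCast _) (by
    have : ((frac p (x + y) - frac p x - frac p y : ℚ) : ℚ_[p])
      = -(x + y - (frac p (x + y) : ℚ_[p])) + ((x - (frac p x : ℚ_[p])) + (y - (frac p y : ℚ_[p]))) := by
      push_cast
      ring
    rw [this]
    exact norm_add_le_one p (by rwa [norm_neg]) (norm_add_le_one p n1 n2))
  exact ⟨k, by linarith⟩

lemma stdChar_add (x y : ℚ_[p]) : stdChar p (x + y) = stdChar p x * stdChar p y := by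
  obtain ⟨k, hk⟩ := frac_add p x y
  unfold stdChar
  rw [hk, ← Complex.exp_add, Complex.exp_eq_exp_iff_exists_int]
  refine ⟨k, ?_⟩
  push_cast
  ring

lemma stdChar_eq_one_iff (y : ℚ_[p]) : stdChar p y = 1 ↔ ‖y‖ ≤ 1 := by
  obtain ⟨h0, h1, ⟨m, hm⟩, hn⟩ := frac_spec p y
  have key : (∃ k : ℤ, frac p y = k) → frac p y = 0 := by
    rintro ⟨k, hk⟩
    rw [hk] at h0 h1 ⊢
    have a : 0 ≤ k := by exact_mod_cast h0
    have b : k < 1 := by exact_mod_cast h1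
    have : k = 0 := by omega
    simp [this]
  constructor
  · intro h
    unfold stdChar at h
    rw [Complex.exp_eq_one_iff] at h
    obtain ⟨k, hk⟩ := h
    have h2 : (2 * (Real.pi : ℂ) * Complex.I) ≠ 0 := Complex.two_pi_I_ne_zero
    have h3 : ((frac p y : ℚ) : ℂ) = ((k : ℚ) : ℂ) := by
      apply mul_left_cancel₀ h2
      rw [hk]
      push_cast
      ring
    have h4 : frac p y = k := by exact_mod_cast h3
    have h5 := key ⟨k, h4⟩
    rw [h5] at hn
    simpa using hn
  · intro h
    have : frac p y = 0 := by
      apply key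
      apply int_of_frac p _ m hm
      have e : (frac p y : ℚ_[p]) = -(y - (frac p y : ℚ_[p])) + y := by ring
      rw [e]
      exact norm_add_le_one p (by rwa [norm_neg]) h
    simp [stdChar, this]

lemma norm_stdChar (y : ℚ_[p]) : ‖stdChar p y‖ = 1 := by
  unfold stdChar
  have : (2 * (Real.pi : ℂ) * Complex.I * (frac p y : ℂ))
    = ((2 * Real.pi * (frac p y : ℝ) : ℝ) : ℂ) * Complex.I := by
    push_cast
    ring
  rw [this, Complex.norm_exp_ofReal_mul_I]

lemma continuous_stdChar : Continuous (stdChar p) := by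
  apply IsLocallyConstant.continuous
  rw [IsLocallyConstant.iff_eventually_eq]
  intro x
  filter_upwards [Metric.ball_mem_nhds x one_pos] with y hy
  have h1 : stdChar p (y - x) = 1 := by
    rw [stdChar_eq_one_iff, ← dist_eq_norm]
    exact (Metric.mem_ball.1 hy).le
  have h2 := stdChar_add p (y - x) x
  rw [sub_add_cancel, h1, one_mul] at h2
  exact h2

lemma continuous_char (ξ : V p n) : Continuous (fun x : V p n => stdChar p (dotP p n ξ x)) := by
  apply (continuous_stdChar p).comp
  unfold dotP
  fun_prop

lemma dotP_add (ξ x y : V p n) : dotP p n ξ (x + y) = dotP p n ξ x + dotP p n ξ y := by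
  simp [dotP, mul_add, Finset.sum_add_distrib]

lemma norm_dotP_le (ξ x : V p n) : ‖dotP p n ξ x‖ ≤ ‖ξ‖ * ‖x‖ := by
  unfold dotP
  apply IsUltrametricDist.norm_sum_le_of_forall_le_of_nonneg (by positivity)
  intro i _
  rw [norm_mul]
  exact mul_le_mul (norm_le_pi_norm ξ i) (norm_le_pi_norm x i) (norm_nonneg _) (norm_nonneg _)

/-! ### Balls -/

/-- the ball of radius `p^k`. -/
def BB (k : ℤ) : Set (V p n) := {x | ‖x‖ ≤ (p : ℝ) ^ k}

lemma measurableSet_BB (k : ℤ) : MeasurableSet (BB p n k) :=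
  (isClosed_le continuous_norm continuous_const).measurableSet

lemma BB_add {k : ℤ} {a x : V p n} (ha : a ∈ BB p n k) : x + a ∈ BB p n k ↔ x ∈ BB p n k := by
  have key : ∀ u v : V p n, u ∈ BB p n k → v ∈ BB p n k → u + v ∈ BB p n k := by
    intro u v hu hv
    unfold BB at *
    simp only [Set.mem_setOf_eq] at *
    rw [pi_norm_le_iff_of_nonneg (zpow_nonneg (p_pos p).le _)] at *
    intro i
    exact (Padic.nonarchimedean _ _).trans (max_le (hu i) (hv i))
  constructor
  · intro h
    have := key _ (-a) h (by simpa [BB] using ha)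
    simpa using this
  · intro h
    exact key _ _ h ha

lemma digit (x : ℚ_[p]) (k : ℤ) (hx : ‖x‖ ≤ (p : ℝ) ^ (k + 1)) :
    ∃ a : Fin p, ‖x - (a : ℕ) * (p : ℚ_[p]) ^ (-(k + 1))‖ ≤ (p : ℝ) ^ k := by
  have hp' : (p : ℚ_[p]) ≠ 0 := by exact_mod_cast (Fact.out : p.Prime).ne_zero
  have hpm : (0 : ℝ) < (p : ℝ) ^ (k + 1) := zpow_pos (p_pos p) _
  have hz : ‖x * (p : ℚ_[p]) ^ (k + 1)‖ ≤ 1 := by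
    rw [norm_mul, Padic.norm_p_zpow, zpow_neg]
    exact (mul_inv_le_iff₀ hpm).2 (by simpa using hx)
  let z : ℤ_[p] := ⟨x * (p : ℚ_[p]) ^ (k + 1), hz⟩
  have h1 := PadicInt.appr_spec 1 z
  rw [← PadicInt.norm_le_pow_iff_mem_span_pow] at h1
  have h2 := PadicInt.appr_lt z 1
  rw [pow_one] at h2
  refine ⟨⟨z.appr 1, h2⟩, ?_⟩
  have h3 : ‖x * (p : ℚ_[p]) ^ (k + 1) - (z.appr 1 : ℚ_[p])‖ ≤ (p : ℝ) ^ (-1 : ℤ) := by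
    have := h1
    rw [PadicInt.norm_def] at this
    push_cast at this
    exact this
  have h4 : x - (z.appr 1 : ℚ_[p]) * (p : ℚ_[p]) ^ (-(k + 1))
      = (x * (p : ℚ_[p]) ^ (k + 1) - (z.appr 1 : ℚ_[p])) * (p : ℚ_[p]) ^ (-(k + 1)) := by
    rw [sub_mul, mul_assoc, ← zpow_add₀ hp']
    simp
  show ‖x - (z.appr 1 : ℚ_[p]) * (p : ℚ_[p]) ^ (-(k + 1))‖ ≤ _
  rw [h4, norm_mul, Padic.norm_p_zpow, neg_neg]
  calc _ ≤ (p : ℝ) ^ (-1 : ℤ) * (p : ℝ) ^ (k + 1) := by gcongr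
    _ = (p : ℝ) ^ k := by
      rw [← zpow_add₀ (p_pos p).ne']
      congr 1
      ring

lemma digit_unique (x : ℚ_[p]) (k : ℤ) (a b : Fin p)
    (ha : ‖x - (a : ℕ) * (p : ℚ_[p]) ^ (-(k + 1))‖ ≤ (p : ℝ) ^ k)
    (hb : ‖x - (b : ℕ) * (p : ℚ_[p]) ^ (-(k + 1))‖ ≤ (p : ℝ) ^ k) : a = b := by
  have h1 : ‖(((a : ℕ) - (b : ℕ) : ℤ) : ℚ_[p]) * (p : ℚ_[p]) ^ (-(k + 1))‖ ≤ (p : ℝ) ^ k := by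
    have e : (((a : ℕ) - (b : ℕ) : ℤ) : ℚ_[p]) * (p : ℚ_[p]) ^ (-(k + 1))
      = (x - (b : ℕ) * (p : ℚ_[p]) ^ (-(k + 1))) + -(x - (a : ℕ) * (p : ℚ_[p]) ^ (-(k + 1))) := by
      push_cast
      ring
    rw [e]
    exact (Padic.nonarchimedean _ _).trans (max_le hb (by rwa [norm_neg]))
  rw [norm_mul, Padic.norm_p_zpow, neg_neg] at h1
  have hpk := zpow_pos (p_pos p) k
  have h2 : ‖(((a : ℕ) - (b : ℕ) : ℤ) : ℚ_[p])‖ < 1 := by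
    by_contra! hc
    have : (p : ℝ) ^ (k + 1) ≤ (p : ℝ) ^ k := by
      refine le_trans ?_ h1
      exact le_mul_of_one_le_left (zpow_nonneg (p_pos p).le _) hc
    have h3 : (p : ℝ) ^ k < (p : ℝ) ^ (k + 1) := zpow_lt_zpow_right₀ (one_lt_p p) (by omega)
    linarith
  rw [Padic.norm_intCast_lt_one_iff] at h2
  have := Int.eq_zero_of_abs_lt_dvd h2 (by
    have := a.2
    have := b.2
    rw [abs_lt]
    omega)
  ext
  omega

section meas

variable (μ : Measure (V p n)) [μ.IsAddHaarMeasure]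

lemma meas_succ (k : ℤ) : μ (BB p n (k + 1)) = (p : ENNReal) ^ n * μ (BB p n k) := by
  let c : (Fin n → Fin p) → V p n := fun a i => ((a i : ℕ) : ℚ_[p]) * (p : ℚ_[p]) ^ (-(k + 1))
  let S : (Fin n → Fin p) → Set (V p n) := fun a => (fun x => x + -c a) ⁻¹' BB p n k
  have hS : ∀ a x, x ∈ S a ↔ ∀ i, ‖x i - ((a i : ℕ) : ℚ_[p]) * (p : ℚ_[p]) ^ (-(k + 1))‖ ≤ (p : ℝ) ^ k := by
    intro a x
    show ‖x + -c a‖ ≤ _ ↔ _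
    rw [pi_norm_le_iff_of_nonneg (zpow_nonneg (p_pos p).le _)]
    simp only [← sub_eq_add_neg]
    rfl
  have hU : BB p n (k + 1) = ⋃ a, S a := by
    ext x
    rw [Set.mem_iUnion]
    constructor
    · intro hx
      have hx' := (pi_norm_le_iff_of_nonneg (zpow_nonneg (p_pos p).le _)).1 hx
      choose a ha using fun i => digit p (x i) k (hx' i)
      exact ⟨a, (hS a x).2 ha⟩
    · rintro ⟨a, ha⟩
      have ha' : x + -c a ∈ BB p n (k + 1) := by
        refine le_trans (show ‖x + -c a‖ ≤ (p : ℝ) ^ k from ha) ?_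
        exact zpow_le_zpow_right₀ (one_lt_p p).le (by omega)
      have hc : -c a ∈ BB p n (k + 1) := by
        show ‖-c a‖ ≤ _
        rw [norm_neg, pi_norm_le_iff_of_nonneg (zpow_nonneg (p_pos p).le _)]
        intro i
        show ‖((a i : ℕ) : ℚ_[p]) * (p : ℚ_[p]) ^ (-(k + 1))‖ ≤ _
        rw [norm_mul, Padic.norm_p_zpow, neg_neg]
        apply mul_le_of_le_one_left (zpow_nonneg (p_pos p).le _)
        exact_mod_cast Padic.norm_int_le_one (p := p) ((a i : ℕ) : ℤ)
      exact (BB_add p n hc).1 ha'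
  rw [hU, measure_iUnion]
  · simp only [S, measure_preimage_add_right]
    rw [tsum_fintype]
    simp
  · intro a b hab
    rw [Function.onFun, Set.disjoint_left]
    intro x hxa hxb
    apply hab
    funext i
    exact digit_unique p (x i) k _ _ ((hS a x).1 hxa i) ((hS b x).1 hxb i)
  · intro a
    exact (measurable_add_const _) (measurableSet_BB p n k)

lemma meas_BB (hμ : μ (Zpn p n) = 1) (k : ℤ) : μ.real (BB p n k) = (p : ℝ) ^ (n * k) := by
  have hs : ∀ k, μ.real (BB p n (k + 1)) = (p : ℝ) ^ n * μ.real (BB p n k) := by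
    intro k
    simp [Measure.real, meas_succ, ENNReal.toReal_mul]
  have hp := (p_pos p).ne'
  have h0 : μ.real (BB p n 0) = 1 := by
    have : BB p n 0 = Zpn p n := by simp [BB, Zpn]
    rw [this, Measure.real, hμ]
    simp
  induction k using Int.induction_on with
  | zero => simpa using h0
  | succ k ih =>
    rw [hs, ih, mul_add, zpow_add₀ hp, mul_one, zpow_natCast, mul_comm]
  | pred k ih =>
    have := hs (-(k : ℤ) - 1)
    rw [sub_add_cancel, ih] at this
    rw [mul_sub, zpow_sub₀ hp, this, mul_one, zpow_natCast]
    field_simp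

lemma integrableOn_char (hμ : μ (Zpn p n) = 1) (ξ : V p n) (k : ℤ) :
    IntegrableOn (fun x => 1 - stdChar p (dotP p n ξ x)) (BB p n k) μ := by
  have hfin : μ (BB p n k) < ⊤ := by
    have h1 := meas_BB p n μ hμ k
    by_contra h
    rw [not_lt, top_le_iff] at h
    rw [Measure.real, h] at h1
    have := zpow_pos (p_pos p) (n * k)
    simp at h1
    linarith
  refine Measure.integrableOn_of_bounded (M := 2) hfin.ne ?_ ?_
  · exact (continuous_const.sub (continuous_char p n ξ)).measurable.aestronglyMeasurable
  · refine Filter.Eventually.of_forall fun x => ?_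
    refine (norm_sub_le _ _).trans ?_
    rw [norm_stdChar]
    norm_num

lemma int_big (hμ : μ (Zpn p n) = 1) (hn : 0 < n) (ξ : V p n) (m k : ℤ) (hm : ‖ξ‖ = (p : ℝ) ^ (-m)) (hk : m < k) :
    ∫ x in BB p n k, (1 - stdChar p (dotP p n ξ x)) ∂μ = ((p : ℝ) ^ (n * k) : ℝ) := by
  -- find a
  obtain ⟨i, hi⟩ : ∃ i, ‖ξ i‖ = ‖ξ‖ := by
    haveI : Nonempty (Fin n) := ⟨⟨0, hn⟩⟩
    obtain ⟨i, -, hi⟩ := Finset.exists_mem_eq_sup' Finset.univ_nonempty (fun i => ‖ξ i‖)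
    refine ⟨i, le_antisymm (norm_le_pi_norm ξ i) ?_⟩
    rw [← hi]
    rw [pi_norm_le_iff_of_nonempty]
    intro j
    exact Finset.le_sup' (fun i => ‖ξ i‖) (Finset.mem_univ j)
  let a : V p n := Pi.single i ((p : ℚ_[p]) ^ (-k))
  have ha : a ∈ BB p n k := by
    show ‖a‖ ≤ _
    rw [Pi.norm_single, Padic.norm_p_zpow, neg_neg]
  have hd : dotP p n ξ a = ξ i * (p : ℚ_[p]) ^ (-k) := by
    simp [dotP, a, Pi.single_apply]
  have hne : stdChar p (dotP p n ξ a) ≠ 1 := by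
    rw [Ne, stdChar_eq_one_iff, hd, norm_mul, hi, hm, Padic.norm_p_zpow, neg_neg, ← zpow_add₀ (p_pos p).ne', not_le]
    exact one_lt_zpow₀ (one_lt_p p) (by omega)
  have hz : ∫ x in BB p n k, stdChar p (dotP p n ξ x) ∂μ = 0 := by
    rw [← integral_indicator (measurableSet_BB p n k)]
    set F : V p n → ℂ := (BB p n k).indicator (fun x => stdChar p (dotP p n ξ x)) with hF
    have h1 : ∫ x, F (x + a) ∂μ = ∫ x, F x ∂μ := integral_add_right_eq_self F a
    have h2 : ∀ x, F (x + a) = stdChar p (dotP p n ξ a) * F x := by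
      intro x
      by_cases hx : x ∈ BB p n k
      · rw [hF, Set.indicator_of_mem hx, Set.indicator_of_mem ((BB_add p n ha).2 hx), dotP_add,
          stdChar_add, mul_comm]
      · rw [hF, Set.indicator_of_notMem hx, Set.indicator_of_notMem (fun h => hx ((BB_add p n ha).1 h)),
          mul_zero]
    simp only [h2, integral_const_mul] at h1
    by_contra h3
    exact hne (mul_right_cancel₀ h3 (by rw [h1, one_mul]))
  have hfin : μ (BB p n k) ≠ ⊤ := by
    intro h
    have h1 := meas_BB p n μ hμ k
    rw [Measure.real, h] at h1
    have := zpow_pos (p_pos p) (n * k)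
    simp at h1
    linarith
  have hc : IntegrableOn (fun _ : V p n => (1 : ℂ)) (BB p n k) μ := integrableOn_const hfin
  have hi2 : IntegrableOn (fun x => stdChar p (dotP p n ξ x)) (BB p n k) μ := by
    have := hc.sub (integrableOn_char p n μ hμ ξ k)
    refine this.congr_fun (fun x _ => ?_) (measurableSet_BB p n k)
    simp
  rw [integral_sub hc hi2, hz, sub_zero, setIntegral_const, meas_BB p n μ hμ k]
  simp

lemma int_small (ξ : V p n) (m : ℤ) (hm : ‖ξ‖ = (p : ℝ) ^ (-m)) (x : V p n) (hx : x ∈ BB p n m) :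
    stdChar p (dotP p n ξ x) = 1 := by
  rw [stdChar_eq_one_iff]
  refine (norm_dotP_le p n ξ x).trans ?_
  rw [hm]
  calc _ ≤ (p : ℝ) ^ (-m) * (p : ℝ) ^ m :=
        mul_le_mul_of_nonneg_left hx (zpow_nonneg (p_pos p).le _)
    _ = 1 := by rw [← zpow_add₀ (p_pos p).ne']; simp

end meas

lemma norm_zpow (hn : 0 < n) (x : V p n) (hx : x ≠ 0) : ∃ m : ℤ, ‖x‖ = (p : ℝ) ^ m := by
  haveI : Nonempty (Fin n) := ⟨⟨0, hn⟩⟩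
  obtain ⟨i, hi⟩ : ∃ i, ‖x i‖ = ‖x‖ := by
    obtain ⟨i, -, hi⟩ := Finset.exists_mem_eq_sup' Finset.univ_nonempty (fun i => ‖x i‖)
    refine ⟨i, le_antisymm (norm_le_pi_norm x i) ?_⟩
    rw [← hi]
    rw [pi_norm_le_iff_of_nonempty]
    intro j
    exact Finset.le_sup' (fun i => ‖x i‖) (Finset.mem_univ j)
  have hxi : x i ≠ 0 := by
    intro h
    rw [h, norm_zero] at hi
    exact hx (norm_eq_zero.1 hi.symm)
  exact ⟨_, by rw [← hi, Padic.norm_eq_zpow_neg_valuation hxi]⟩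

lemma norm_repVec (hn : 0 < n) (k : ℤ) : ‖repVec p n ((p : ℝ) ^ k)‖ = (p : ℝ) ^ k := by
  have h : ∃ v : V p n, ‖v‖ = (p : ℝ) ^ k :=
    ⟨Pi.single ⟨0, hn⟩ ((p : ℚ_[p]) ^ (-k)), by rw [Pi.norm_single, Padic.norm_p_zpow, neg_neg]⟩
  unfold repVec
  rw [dif_pos h]
  exact h.choose_spec

/-- the sphere of radius `p^k`. -/
def SS (k : ℤ) : Set (V p n) := BB p n k \ BB p n (k - 1)

lemma mem_SS (hn : 0 < n) (k : ℤ) (x : V p n) : x ∈ SS p n k ↔ ‖x‖ = (p : ℝ) ^ k := by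
  constructor
  · rintro ⟨h1, h2⟩
    have h2 : ¬ ‖x‖ ≤ (p : ℝ) ^ (k - 1) := h2
    have h1 : ‖x‖ ≤ (p : ℝ) ^ k := h1
    have hx : x ≠ 0 := by
      rintro rfl
      apply h2
      rw [norm_zero]
      exact zpow_nonneg (p_pos p).le _
    obtain ⟨m, hm⟩ := norm_zpow p n hn x hx
    rw [hm] at h1 h2 ⊢
    rw [zpow_le_zpow_iff_right₀ (one_lt_p p)] at h1 h2
    congr 1
    omega
  · intro h
    refine ⟨h.le, ?_⟩
    show ¬ ‖x‖ ≤ (p : ℝ) ^ (k - 1)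
    rw [h, zpow_le_zpow_iff_right₀ (one_lt_p p)]
    omega

lemma int_SS (hn : 0 < n) (μ : Measure (V p n)) [μ.IsAddHaarMeasure]
    (hμ : μ (Zpn p n) = 1) (J : V p n → ℝ) (hJ : HypA p n μ J) (ξ : V p n) (k : ℤ) :
    ∫ x in SS p n k, (1 - stdChar p (dotP p n ξ x)) * (J x : ℂ) ∂μ =
      ((∫ x in BB p n k, (1 - stdChar p (dotP p n ξ x)) ∂μ) -
        ∫ x in BB p n (k - 1), (1 - stdChar p (dotP p n ξ x)) ∂μ) *
        (J (repVec p n ((p : ℝ) ^ k)) : ℂ) := by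
  have hsub : BB p n (k - 1) ⊆ BB p n k := fun x hx =>
    le_trans (show ‖x‖ ≤ _ from hx) (zpow_le_zpow_right₀ (one_lt_p p).le (by omega))
  rw [← integral_diff (measurableSet_BB p n _) (integrableOn_char p n μ hμ ξ k) hsub,
    ← integral_mul_const]
  apply setIntegral_congr_fun ((measurableSet_BB p n _).diff (measurableSet_BB p n _))
  intro x hx
  have := (mem_SS p n hn k x).1 hx
  show _ * _ = _ * _
  rw [hJ.radial x _ (this.trans (norm_repVec p n hn k).symm)]

/-- If `J` satisfies Hypothesis A then for `ξ ≠ 0`,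
`1 - (FJ)(ξ) = ‖ξ‖^{-n} (p^n J(p‖ξ‖⁻¹) + (1-p^{-n}) Σ_{j=2}^∞ p^{nj} J(p^j‖ξ‖⁻¹))`,
where `J(r)` is the value of the radial function `J` on the sphere of radius `r`. -/
theorem statement1 (hn : 0 < n) (μ : Measure (V p n)) [μ.IsAddHaarMeasure]
    (hμ : μ (Zpn p n) = 1) (J : V p n → ℝ) (hJ : HypA p n μ J) :
    ∀ ξ : V p n, ξ ≠ 0 →
      1 - FJ p n μ J ξ =
        ((‖ξ‖ ^ (-(n : ℤ)) *
          ((p : ℝ) ^ (n : ℕ) * J (repVec p n ((p : ℝ) * ‖ξ‖⁻¹)) +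
            (1 - (p : ℝ) ^ (-(n : ℤ))) *
              ∑' j : ℕ, (p : ℝ) ^ (n * (j + 2)) *
                J (repVec p n ((p : ℝ) ^ ((j : ℤ) + 2) * ‖ξ‖⁻¹))) : ℝ) : ℂ) := by
  intro ξ hξ
  obtain ⟨m', hm'⟩ := norm_zpow p n hn ξ hξ
  obtain ⟨m, rfl⟩ : ∃ m, m' = -m := ⟨-m', by ring⟩
  have hp := (p_pos p).ne'
  have hJc : Integrable (fun x => (J x : ℂ)) μ := hJ.integrable.ofReal
  have hchi : Integrable (fun x => stdChar p (dotP p n ξ x) * (J x : ℂ)) μ := by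
    refine hJc.bdd_mul (c := 1) (continuous_char p n ξ).measurable.aestronglyMeasurable ?_
    exact Filter.Eventually.of_forall fun x => (norm_stdChar p _).le
  set G : V p n → ℂ := fun x => (1 - stdChar p (dotP p n ξ x)) * (J x : ℂ) with hG
  have hGi : Integrable G μ := by
    refine (hJc.sub hchi).congr (Filter.Eventually.of_forall fun x => ?_)
    simp only [Pi.sub_apply, hG]
    ring
  have e1 : 1 - FJ p n μ J ξ = ∫ x, G x ∂μ := by
    have h1 : (1 : ℂ) = ∫ x, (J x : ℂ) ∂μ := by
      rw [integral_complex_ofReal, hJ.int_one]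
      simp
    unfold FJ FT
    rw [h1, ← integral_sub hJc hchi]
    congr 1
    funext x
    simp only [hG]
    ring
  let S : ℕ → Set (V p n) := fun j => SS p n (m + 1 + j)
  have hcompl : (⋃ j, S j) = (BB p n m)ᶜ := by
    ext x
    rw [Set.mem_iUnion]
    constructor
    · rintro ⟨j, hj⟩ hx
      have h1 := (mem_SS p n hn _ x).1 hj
      have h2 : ‖x‖ ≤ (p : ℝ) ^ m := hx
      rw [h1, zpow_le_zpow_iff_right₀ (one_lt_p p)] at h2
      omega
    · intro hx
      have h2 : ¬ ‖x‖ ≤ (p : ℝ) ^ m := hx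
      have hx0 : x ≠ 0 := by
        rintro rfl
        apply h2
        rw [norm_zero]
        exact zpow_nonneg (p_pos p).le _
      obtain ⟨l, hl⟩ := norm_zpow p n hn x hx0
      rw [hl, zpow_le_zpow_iff_right₀ (one_lt_p p)] at h2
      refine ⟨(l - m - 1).toNat, (mem_SS p n hn _ x).2 ?_⟩
      rw [hl]
      congr 1
      omega
  have e2 : ∫ x, G x ∂μ = ∫ x in ⋃ j, S j, G x ∂μ := by
    rw [hcompl, ← integral_add_compl (measurableSet_BB p n m) hGi]
    rw [setIntegral_eq_zero_of_forall_eq_zero, zero_add]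
    intro x hx
    simp [hG, int_small p n ξ m hm' x hx]
  have hsum := hasSum_integral_iUnion (μ := μ) (f := G) (s := S)
    (fun j => (measurableSet_BB p n _).diff (measurableSet_BB p n _))
    (by
      intro i j hij
      rw [Function.onFun, Set.disjoint_left]
      intro x hi hj
      apply hij
      have h1 := (mem_SS p n hn _ x).1 hi
      rw [(mem_SS p n hn _ x).1 hj] at h1
      have := zpow_right_injective₀ (p_pos p) (one_lt_p p).ne' h1
      omega) hGi.integrableOn
  have hR : ∀ k : ℤ, (p : ℝ) ^ k * ‖ξ‖⁻¹ = (p : ℝ) ^ (m + k) := by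
    intro k
    rw [hm', ← zpow_neg, neg_neg, ← zpow_add₀ hp, add_comm]
  have hR1 : (p : ℝ) * ‖ξ‖⁻¹ = (p : ℝ) ^ (m + 1) := by
    simpa using hR 1
  have hξn : ‖ξ‖ ^ (-(n : ℤ)) = (p : ℝ) ^ ((n : ℤ) * m) := by
    rw [hm', ← zpow_mul]
    congr 1
    ring
  -- values
  have hv0 : ∫ x in S 0, G x ∂μ =
      (((p : ℝ) ^ ((n : ℤ) * m) * ((p : ℝ) ^ n * J (repVec p n ((p : ℝ) ^ (m + 1)))) : ℝ) : ℂ) := by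
    have := int_SS p n hn μ hμ J hJ ξ (m + 1)
    have hz : ∫ x in BB p n m, (1 - stdChar p (dotP p n ξ x)) ∂μ = 0 := by
      apply setIntegral_eq_zero_of_forall_eq_zero
      intro x hx
      rw [int_small p n ξ m hm' x hx, sub_self]
    rw [add_sub_cancel_right, hz, sub_zero, int_big p n μ hμ hn ξ m (m + 1) hm' (by omega)] at this
    simp only [S, Nat.cast_zero, add_zero]
    rw [this, mul_add, mul_one, zpow_add₀ hp, zpow_natCast]
    push_cast
    ring
  have hv : ∀ j : ℕ, ∫ x in S (j + 1), G x ∂μ =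
      (((p : ℝ) ^ ((n : ℤ) * m) * ((1 - (p : ℝ) ^ (-(n : ℤ))) * ((p : ℝ) ^ (n * (j + 2)) *
        J (repVec p n ((p : ℝ) ^ (m + ((j : ℤ) + 2)))))) : ℝ) : ℂ) := by
    intro j
    have := int_SS p n hn μ hμ J hJ ξ (m + ((j : ℤ) + 2))
    rw [int_big p n μ hμ hn ξ m _ hm' (by omega), int_big p n μ hμ hn ξ m _ hm' (by omega)] at this
    have hi : m + 1 + ((j + 1 : ℕ) : ℤ) = m + ((j : ℤ) + 2) := by
      push_cast
      ring
    simp only [S]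
    rw [hi, this, ← Complex.ofReal_sub, ← Complex.ofReal_mul]
    congr 1
    have a1 : (p : ℝ) ^ ((n : ℤ) * (m + ((j : ℤ) + 2)))
        = (p : ℝ) ^ ((n : ℤ) * m) * (p : ℝ) ^ (n * (j + 2)) := by
      rw [mul_add, zpow_add₀ hp, ← zpow_natCast (p : ℝ) (n * (j + 2))]
      push_cast
      rfl
    have a2 : (p : ℝ) ^ ((n : ℤ) * (m + ((j : ℤ) + 2) - 1))
        = (p : ℝ) ^ ((n : ℤ) * m) * (p : ℝ) ^ (n * (j + 2)) * (p : ℝ) ^ (-(n : ℤ)) := by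
      rw [← a1, ← zpow_add₀ hp]
      congr 1
      ring
    rw [a1, a2]
    ring
  rw [e1, e2, ← hsum.tsum_eq, hsum.summable.tsum_eq_zero_add, hv0]
  simp only [hv]
  rw [← Complex.ofReal_tsum, ← Complex.ofReal_add]
  congr 1
  simp only [hR, hR1, hξn, tsum_mul_left]
  ring

end PadicPaper
end
end

section
/- Let J : ℚ_p^n → [0,∞) satisfy Hypothesis A and assume that ξ ↦ 1 − (FJ)(ξ) is nondecreasing as a function of ‖ξ‖_p. Then for every t > 0 and every x ∈ ℚ_p^n with x ≠ 0, the heat kernel satisfies 0 ≤ Z_t(x) ≤ ‖x‖_p^{−n}. -/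
open MeasureTheory Filter

noncomputable section

namespace PadicPaper

attribute [local instance] Classical.propDecidable

variable (p : ℕ) [Fact p.Prime]

variable (n : ℕ)

lemma FJ_re_le (μ : Measure (V p n)) (J : V p n → ℝ) (hJ : HypA p n μ J) (ξ : V p n) :
    (FJ p n μ J ξ).re ≤ 1 := by
  refine (Complex.re_le_norm _).trans ?_
  unfold FJ FT
  refine (norm_integral_le_integral_norm _).trans (le_of_eq ?_)
  rw [← hJ.int_one]
  congr 1
  funext x
  rw [norm_mul, norm_stdChar, one_mul, Complex.norm_real, Real.norm_of_nonneg (hJ.nonneg x)]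

lemma norm_repVec_le (r : ℝ) (hr : 0 ≤ r) : ‖repVec p n r‖ ≤ r := by
  unfold repVec
  split_ifs with h
  · exact h.choose_spec.le
  · simpa using hr

lemma norm_repVec_eq (hn : 0 < n) (x : V p n) :
    ‖repVec p n ((p : ℝ) * ‖x‖⁻¹)‖ = (p : ℝ) * ‖x‖⁻¹ := by
  have h : ∃ v : V p n, ‖v‖ = (p : ℝ) * ‖x‖⁻¹ := by
    haveI : Nonempty (Fin n) := ⟨⟨0, hn⟩⟩
    obtain ⟨i, hi⟩ := Finite.exists_max (fun i => ‖x i‖)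
    have hx : ‖x‖ = ‖x i‖ :=
      le_antisymm ((pi_norm_le_iff_of_nonneg (norm_nonneg _)).2 hi) (norm_le_pi_norm x i)
    refine ⟨Pi.single i ((p : ℚ_[p])⁻¹ * (x i)⁻¹), ?_⟩
    rw [Pi.norm_single, norm_mul, norm_inv, norm_inv, Padic.norm_p, inv_inv, hx]
  unfold repVec
  rw [dif_pos h]
  exact h.choose_spec

/-- If `J` satisfies Hypothesis A and `1 - (FJ)` is nondecreasing in `‖ξ‖`, then
`0 ≤ Z_t(x) ≤ ‖x‖^{-n}` for all `t > 0` and `x ≠ 0`. -/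
theorem statement4 (hn : 0 < n) (μ : Measure (V p n)) [μ.IsAddHaarMeasure]
    (hμ : μ (Zpn p n) = 1) (J : V p n → ℝ) (hJ : HypA p n μ J)
    (hmono : ∀ ξ η : V p n, ‖ξ‖ ≤ ‖η‖ →
      (1 - FJ p n μ J ξ).re ≤ (1 - FJ p n μ J η).re) :
    ∀ t : ℝ, 0 < t → ∀ x : V p n, x ≠ 0 →
      0 ≤ heatZ p n μ J t x ∧ heatZ p n μ J t x ≤ ‖x‖ ^ (-(n : ℤ)) := by
  intro t ht x hx
  have hx0 : 0 < ‖x‖ := norm_pos_iff.2 hx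
  have hp1 : (1 : ℝ) < p := by exact_mod_cast (Fact.out : p.Prime).one_lt
  have hp0 : (0 : ℝ) < p := by linarith
  set q : ℝ := (p : ℝ) ^ (-(n : ℤ)) with hq
  have hq0 : 0 < q := by positivity
  have hq1 : q < 1 := zpow_lt_one_of_neg₀ hp1 (by omega)
  have hqj : ∀ j : ℕ, (p : ℝ) ^ (-((n * j : ℕ) : ℤ)) = q ^ j := by
    intro j
    rw [hq, ← zpow_natCast, ← zpow_mul]
    congr 1
    push_cast
    ring
  set D : ℕ → ℝ := fun j =>
      (Real.exp (-(t * (1 - (FJ p n μ J (repVec p n ((p : ℝ) ^ (-(j : ℤ)) * ‖x‖⁻¹))).re))) -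
       Real.exp (-(t * (1 - (FJ p n μ J (repVec p n ((p : ℝ) * ‖x‖⁻¹))).re)))) with hD
  have hZ : heatZ p n μ J t x = ‖x‖ ^ (-(n : ℤ)) * (1 - q) * ∑' j : ℕ, q ^ j * D j := by
    unfold heatZ
    simp only [hqj, hD, hq]
  have hD0 : ∀ j, 0 ≤ D j := by
    intro j
    have h1 : ‖repVec p n ((p : ℝ) ^ (-(j : ℤ)) * ‖x‖⁻¹)‖ ≤ ‖repVec p n ((p : ℝ) * ‖x‖⁻¹)‖ := by
      rw [norm_repVec_eq p n hn x]
      refine (norm_repVec_le p n _ (by positivity)).trans ?_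
      refine mul_le_mul_of_nonneg_right ?_ (by positivity)
      exact (zpow_le_one_of_nonpos₀ hp1.le (by omega)).trans hp1.le
    have h2 := hmono _ _ h1
    simp only [Complex.sub_re, Complex.one_re] at h2
    simp only [hD, sub_nonneg]
    exact Real.exp_le_exp.2 (neg_le_neg (mul_le_mul_of_nonneg_left h2 ht.le))
  have hD1 : ∀ j, D j ≤ 1 := by
    intro j
    have h1 := FJ_re_le p n μ J hJ (repVec p n ((p : ℝ) ^ (-(j : ℤ)) * ‖x‖⁻¹))
    have h2 : Real.exp
        (-(t * (1 - (FJ p n μ J (repVec p n ((p : ℝ) ^ (-(j : ℤ)) * ‖x‖⁻¹))).re))) ≤ 1 := by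
      rw [Real.exp_le_one_iff, neg_nonpos]
      exact mul_nonneg ht.le (by linarith)
    have h3 := Real.exp_pos (-(t * (1 - (FJ p n μ J (repVec p n ((p : ℝ) * ‖x‖⁻¹))).re)))
    simp only [hD]
    linarith
  have hg := hasSum_geometric_of_lt_one hq0.le hq1
  have hle : ∀ j, q ^ j * D j ≤ q ^ j := fun j =>
    mul_le_of_le_one_right (by positivity) (hD1 j)
  have hnn : ∀ j, 0 ≤ q ^ j * D j := fun j => mul_nonneg (by positivity) (hD0 j)
  have hs : Summable fun j => q ^ j * D j := Summable.of_nonneg_of_le hnn hle hg.summable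
  have hS : ∑' j : ℕ, q ^ j * D j ≤ (1 - q)⁻¹ := by
    rw [← hg.tsum_eq]
    exact hs.tsum_le_tsum hle hg.summable
  have hS0 : 0 ≤ ∑' j : ℕ, q ^ j * D j := tsum_nonneg hnn
  have hq' : 0 < 1 - q := by linarith
  have hX : 0 ≤ ‖x‖ ^ (-(n : ℤ)) := by positivity
  rw [hZ]
  refine ⟨by positivity, ?_⟩
  rw [mul_assoc]
  refine mul_le_of_le_one_right hX ?_
  calc (1 - q) * ∑' j : ℕ, q ^ j * D j ≤ (1 - q) * (1 - q)⁻¹ :=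
        mul_le_mul_of_nonneg_left hS hq'.le
    _ = 1 := mul_inv_cancel₀ hq'.ne'

end PadicPaper
end
end

section
/- Let J : ℚ_p^n → [0,∞) be of linear type or of logarithmic type. Then 1 − (FJ)(ξ) > 0 for every ξ ∈ ℚ_p^n with ‖ξ‖_p = 1. -/
open MeasureTheory Filter

noncomputable section

namespace PadicPaper

attribute [local instance] Classical.propDecidable

variable (p : ℕ) [Fact p.Prime]

variable (n : ℕ)

lemma int_of_norm_le (s : ℚ) (M : ℕ) (a : ℤ) (ha : s * (p : ℚ) ^ M = a)
    (hs : ‖(s : ℚ_[p])‖ ≤ 1) : ∃ k : ℤ, s = k := by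
  have hp : (0:ℝ) < p := by exact_mod_cast (Fact.out : p.Prime).pos
  have hpq : (p:ℚ) ≠ 0 := by exact_mod_cast (Fact.out : p.Prime).ne_zero
  have h1 : (s : ℚ_[p]) * (p : ℚ_[p]) ^ M = (a : ℚ_[p]) := by exact_mod_cast ha
  have h2 : ‖(a : ℚ_[p])‖ ≤ (p:ℝ) ^ (-(M:ℤ)) := by
    rw [← h1, norm_mul, norm_pow, Padic.norm_p, zpow_neg, zpow_natCast, inv_pow]
    exact mul_le_of_le_one_left (by positivity) hs
  obtain ⟨k, hk⟩ := (Padic.norm_int_le_pow_iff_dvd a M).1 h2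
  refine ⟨k, ?_⟩
  rw [hk] at ha
  push_cast at ha
  rw [mul_comm] at ha
  exact mul_left_cancel₀ (pow_ne_zero M hpq) ha

lemma frac_add_neg (y : ℚ_[p]) : ∃ k : ℤ, frac p y + frac p (-y) = k := by
  obtain ⟨-, -, ⟨m, hm⟩, h1⟩ := frac_spec p y
  obtain ⟨-, -, ⟨m', hm'⟩, h2⟩ := frac_spec p (-y)
  have e1 := Rat.den_eq_one_iff _ |>.1 hm
  have e2 := Rat.den_eq_one_iff _ |>.1 hm'
  refine int_of_norm_le p _ (m + m')
    ((frac p y * (p : ℚ) ^ m).num * (p:ℤ) ^ m' + (frac p (-y) * (p : ℚ) ^ m').num * (p:ℤ) ^ m) ?_ ?_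
  · push_cast
    rw [e1, e2]
    ring
  · have : ((frac p y + frac p (-y) : ℚ) : ℚ_[p]) =
      -((y - (frac p y : ℚ_[p])) + (-y - (frac p (-y) : ℚ_[p]))) := by push_cast; ring
    rw [this, norm_neg]
    exact (Padic.nonarchimedean _ _).trans (max_le h1 h2)

lemma stdChar_eq (y : ℚ_[p]) :
    stdChar p y = Complex.exp (((2 * Real.pi * (frac p y : ℝ) : ℝ) : ℂ) * Complex.I) := by
  unfold stdChar
  congr 1
  push_cast
  ring

lemma stdChar_neg (y : ℚ_[p]) : stdChar p (-y) = (starRingEnd ℂ) (stdChar p y) := by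
  obtain ⟨k, hk⟩ := frac_add_neg p y
  have h : (frac p (-y) : ℂ) = k - (frac p y : ℂ) := by
    rw [eq_sub_iff_add_eq, add_comm]
    exact_mod_cast congrArg (fun q : ℚ => (q : ℂ)) hk
  unfold stdChar
  rw [← Complex.exp_conj, h]
  rw [Complex.exp_eq_exp_iff_exists_int]
  refine ⟨k, ?_⟩
  have h2 : (starRingEnd ℂ) 2 = 2 := Complex.conj_ofNat 2
  simp [h2]
  ring

lemma stdChar_re (y : ℚ_[p]) : (stdChar p y).re = Real.cos (2 * Real.pi * (frac p y : ℝ)) := by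
  rw [stdChar_eq, Complex.exp_ofReal_mul_I_re]

lemma stdChar_re_lt (y : ℚ_[p]) (hy : 1 < ‖y‖) : (stdChar p y).re < 1 := by
  obtain ⟨h0, h1, -, h2⟩ := frac_spec p y
  have hne : frac p y ≠ 0 := by
    intro h
    rw [h] at h2
    simp at h2
    linarith
  rw [stdChar_re]
  refine lt_of_le_of_ne (Real.cos_le_one _) fun h => ?_
  have h0' : (0:ℝ) < frac p y := by exact_mod_cast lt_of_le_of_ne h0 hne.symm
  have h1' : (frac p y : ℝ) < 1 := by exact_mod_cast h1
  have hpi := Real.pi_pos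
  have := (Real.cos_eq_one_iff_of_lt_of_lt (x := 2 * Real.pi * (frac p y : ℝ))
    (by nlinarith [mul_pos hpi h0']) (by nlinarith)).1 h
  have := mul_pos (mul_pos two_pos hpi) h0'
  linarith

lemma main_aux (μ : Measure (V p n)) [μ.IsAddHaarMeasure]
    (J : V p n → ℝ) (hA : HypA p n μ J) (hpos : ∀ x, x ≠ 0 → 0 < J x)
    (ξ : V p n) (hξ : ‖ξ‖ = 1) :
    0 < (1 - FJ p n μ J ξ).re ∧ (1 - FJ p n μ J ξ).im = 0 := by
  constructor
  · by_cases hi : Integrable (fun x => stdChar p (dotP p n ξ x) * (J x : ℂ)) μ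
    · have hre : (FJ p n μ J ξ).re = ∫ x, (stdChar p (dotP p n ξ x)).re * J x ∂μ := by
        unfold FJ FT
        have := integral_re hi
        simp only [RCLike.re_eq_complex_re, Complex.re_mul_ofReal] at this
        exact this.symm
      have hi' : Integrable (fun x => (stdChar p (dotP p n ξ x)).re * J x) μ := by
        have := hi.re
        simpa only [RCLike.re_eq_complex_re, Complex.re_mul_ofReal] using this
      rw [Complex.sub_re, Complex.one_re, hre, ← hA.int_one, ← integral_sub hA.integrable hi']
      have hs : Integrable (fun x => J x - (stdChar p (dotP p n ξ x)).re * J x) μ :=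
        hA.integrable.sub hi'
      rw [integral_pos_iff_support_of_nonneg _ hs]
      · have hc : Continuous (dotP p n ξ) := by unfold dotP; fun_prop
        have ho : IsOpen {x : V p n | 1 < ‖dotP p n ξ x‖} :=
          isOpen_lt continuous_const hc.norm
        refine lt_of_lt_of_le (ho.measure_pos μ ?_) (measure_mono ?_)
        · obtain ⟨i, hi0⟩ : ∃ i, ξ i ≠ 0 := by
            by_contra! h
            have : ξ = 0 := funext h
            simp [this] at hξ
          refine ⟨Pi.single i ((p : ℚ_[p])⁻¹ * (ξ i)⁻¹), ?_⟩
          have : dotP p n ξ (Pi.single i ((p : ℚ_[p])⁻¹ * (ξ i)⁻¹)) = (p : ℚ_[p])⁻¹ := by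
            unfold dotP
            rw [Finset.sum_eq_single i]
            · rw [Pi.single_eq_same]; field_simp
            · intro j _ hj; rw [Pi.single_eq_of_ne hj, mul_zero]
            · simp
          rw [Set.mem_setOf_eq, this, norm_inv, Padic.norm_p, inv_inv]
          exact_mod_cast (Fact.out : p.Prime).one_lt
        · intro x hx
          have hx' : 1 < ‖dotP p n ξ x‖ := hx
          have hx0 : x ≠ 0 := by
            rintro rfl
            simp [dotP] at hx'
            linarith
          have := stdChar_re_lt p _ hx'
          rw [Function.mem_support]
          have := mul_pos (sub_pos.2 this) (hpos x hx0)
          apply ne_of_gt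
          linarith
      · intro x
        have h1 : (stdChar p (dotP p n ξ x)).re ≤ 1 := by
          rw [stdChar_re]; exact Real.cos_le_one _
        have := mul_nonneg (sub_nonneg.2 h1) (hA.nonneg x)
        simp only [Pi.zero_apply]
        linarith
    · have : FJ p n μ J ξ = 0 := integral_undef hi
      simp [this]
  · have h : (starRingEnd ℂ) (FJ p n μ J ξ) = FJ p n μ J ξ := by
      unfold FJ FT
      rw [← integral_conj, ← integral_neg_eq_self]
      refine integral_congr_ae (Eventually.of_forall fun x => ?_)
      have hd : dotP p n ξ (-x) = - dotP p n ξ x := by simp [dotP]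
      simp only [map_mul, Complex.conj_ofReal, hd, stdChar_neg, Complex.conj_conj]
      rw [hA.radial (-x) x (norm_neg x)]
    rw [Complex.sub_im, Complex.one_im, Complex.conj_eq_iff_im.1 h, sub_zero]

/-- if `J` is of linear type or of logarithmic type, then `1 - (FJ)(ξ) > 0`
for every `ξ` with `‖ξ‖ = 1`. -/
theorem statement13 (hn : 0 < n) (μ : Measure (V p n)) [μ.IsAddHaarMeasure]
    (hμ : μ (Zpn p n) = 1) (J : V p n → ℝ)
    (hJ : (∃ B C α : ℝ, LinearType p n μ J B C α) ∨
          (∃ D E α β : ℝ, LogType p n μ J D E α β)) :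
    ∀ ξ : V p n, ‖ξ‖ = 1 →
      0 < (1 - FJ p n μ J ξ).re ∧ (1 - FJ p n μ J ξ).im = 0 := by
  rcases hJ with ⟨B, C, α, h⟩ | ⟨D, E, α, β, h⟩
  · refine main_aux p n μ J h.hypA fun x hx => lt_of_lt_of_le ?_ (h.lower x hx)
    have := norm_pos_iff.2 hx
    have := h.hB
    positivity
  · refine main_aux p n μ J h.hypA fun x hx => lt_of_lt_of_le ?_ (h.lower x hx)
    have h1 := norm_pos_iff.2 hx
    have := h.hD
    have : 0 < Real.log (1 + ‖x‖) := Real.log_pos (by linarith)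
    positivity

end PadicPaper
end
end
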